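/- arXiv:2509.07600 — 4 statements merged into one kernel-verified Lean document; each statement's English description precedes it below -/
import Mathlib

section
/- Let m ≥ 1 and let (a_i)_{i≥1} be a sequence of real numbers with a_i ≥ 2 for all i. Define d_1 = a_1 and d_{i+1} = a_{i+1}·d_i − d_{i−1} for i ≥ 1 (with the convention d_0 = 1). Then the sequence (d_i) is strictly increasing: d_{i+1} > d_i for all i ≥ 1; in particular d_{m+1} > 1. -/
/-- Let `m ≥ 1` and let `(a i)` for `i ≥ 1` be real numbers with
`a i ≥ 2`.  Define `d 0 = 1`, `d 1 = a 1` and `d (i+1) = a (i+1) * d i - d (i-1)` for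
`i ≥ 1`.  Then the sequence `d` is strictly increasing from index `1` on
(`d (i+1) > d i` for all `i ≥ 1`); in particular `d (m+1) > 1`. -/
theorem frieze_diagonal_strict_mono_of_two_le
    (m : ℕ) (hm : 1 ≤ m) (a d : ℕ → ℝ)
    (ha : ∀ i, 1 ≤ i → 2 ≤ a i)
    (hd0 : d 0 = 1) (hd1 : d 1 = a 1)
    (hrec : ∀ i, 1 ≤ i → d (i + 1) = a (i + 1) * d i - d (i - 1)) :
    (∀ i, 1 ≤ i → d i < d (i + 1)) ∧ 1 < d (m + 1) := by
  have key : ∀ i, 1 ≤ d i ∧ d i < d (i + 1) := by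
    intro i
    induction i with
    | zero =>
      have := ha 1 le_rfl
      exact ⟨hd0.ge, by rw [zero_add, hd0, hd1]; linarith⟩
    | succ k ih =>
      obtain ⟨h_one, h_lt⟩ := ih
      have h_rec := hrec (k + 1) (by omega)
      rw [Nat.add_sub_cancel] at h_rec
      have h_two := ha (k + 1 + 1) (by omega)
      refine ⟨by linarith, ?_⟩
      nlinarith [mul_nonneg (sub_nonneg.2 h_two) (by linarith : 0 ≤ d (k + 1))]
  exact ⟨fun i _ => (key i).2, (key m).1.trans_lt (key m).2⟩
end

section
/- Let n ≥ 4 and let k be an odd integer with 3 ≤ k < n and gcd(k, n) = 1. Then there exists an integer m with 1 ≤ m ≤ n−2 such that Q_m(2cos(kπ/n)) < 0. (Hence the weight 2cos(kπ/n) with k ≥ 3 generates a frieze pattern with negative entries.) -/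
/-- The polynomials `Q 0 = 1`, `Q 1 = X`, `Q (n+2) = X * Q (n+1) - Q n`. -/
noncomputable def Q : ℕ → Polynomial ℝ
  | 0 => 1
  | 1 => Polynomial.X
  | n + 2 => Polynomial.X * Q (n + 1) - Q n

theorem Q_eq_chebyshev_S : ∀ m : ℕ, Q m = Polynomial.Chebyshev.S ℝ m
  | 0 => by simp [Q]
  | 1 => by simp [Q]
  | m + 2 => by
    rw [Q, Q_eq_chebyshev_S (m + 1), Q_eq_chebyshev_S m]
    push_cast
    rw [Polynomial.Chebyshev.S_add_two]

/-- Let `n ≥ 4` and let `k` be an odd integer with `3 ≤ k < n` and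
`gcd (k, n) = 1`.  Then there is an integer `m` with `1 ≤ m ≤ n - 2` such that
`Q m (2 cos (k π / n)) < 0`.  (Hence the weight `2 cos (k π / n)` with `k ≥ 3`
generates a pattern with negative entries.) -/
theorem Q_neg_entry_of_two_cos (n k : ℕ) (hn : 4 ≤ n) (hk : 3 ≤ k) (hkn : k < n)
    (hodd : Odd k) (hgcd : Nat.gcd k n = 1) :
    ∃ m : ℕ, 1 ≤ m ∧ m ≤ n - 2 ∧
      (Q m).eval (2 * Real.cos ((k : ℝ) * Real.pi / n)) < 0 := by
  have hn0 : (0 : ℝ) < n := by exact_mod_cast (by omega : 0 < n)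
  have hm1 : 1 ≤ n / k := Nat.div_pos hkn.le (by omega)
  have hm2 : n / k ≤ n / 3 := Nat.div_le_div_left hk (by norm_num)
  have hlo : (n : ℝ) < (n / k : ℕ) * k + k := by
    exact_mod_cast Nat.lt_div_mul_add (by omega)
  have hhi : ((n / k : ℕ) : ℝ) * k ≤ n := by exact_mod_cast Nat.div_mul_le_self n k
  have hkn' : (k : ℝ) < n := by exact_mod_cast hkn
  have hk0 : (0 : ℝ) < k := by exact_mod_cast (by omega : 0 < k)
  refine ⟨n / k, hm1, by omega, ?_⟩
  rw [Q_eq_chebyshev_S]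
  generalize n / k = m at hlo hhi ⊢
  set θ : ℝ := (k : ℝ) * Real.pi / n with hθ
  have hsin : 0 < Real.sin θ := by
    apply Real.sin_pos_of_pos_of_lt_pi
    · positivity
    · rw [hθ, div_lt_iff₀ hn0]
      nlinarith [Real.pi_pos]
  have hangle : ((m : ℝ) + 1) * θ = (m * k + k) * Real.pi / n := by rw [hθ]; ring
  have hneg : Real.sin (((m : ℝ) + 1) * θ) < 0 := by
    rw [← Real.sin_sub_two_pi, hangle]
    apply Real.sin_neg_of_neg_of_neg_pi_lt
    · rw [sub_neg, div_lt_iff₀ hn0]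
      nlinarith [Real.pi_pos]
    · rw [lt_sub_iff_add_lt, lt_div_iff₀ hn0]
      nlinarith [Real.pi_pos]
  have h := Polynomial.Chebyshev.S_two_mul_real_cos θ m
  push_cast at h
  exact neg_of_mul_neg_left (h.trans_lt hneg) hsin.le
end

section
/- Let r ≥ 3, s ≥ 3, and let t ∈ ℝ satisfy Q_{r−2}(t) = 1 and Q_{r−1}(t) = 0; write q_l = Q_l(t). Let a_1, …, a_s be real numbers and let (v_j)_{j≥0} and (u_j)_{j≥0} satisfy v_0 = 1, v_1 = a_1, v_{j+1} = a_{j+1}·v_j − v_{j−1}, and u_0 = 1, u_1 = a_2, u_{j+1} = a_{j+2}·u_j − u_{j−1}, with the frieze boundary conditions v_{s−2} = 1, v_{s−1} = 0, u_{s−2} = 1, u_{s−1} = 0. Fix k with 1 ≤ k ≤ r−3 and define coefficients (b_j) by: b_j = t for 1 ≤ j ≤ k, b_{k+1} = a_1 + t, b_{k+1+l} = a_{1+l} for 1 ≤ l ≤ s−2, b_{k+s} = a_s + t, and b_{k+s+l} = t for 1 ≤ l ≤ r−3−k. Let (f_j)_{j≥0} satisfy f_0 = 1, f_1 = b_1,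 f_{j+1} = b_{j+1}·f_j − f_{j−1}. Then: (1) f_l = q_l for 0 ≤ l ≤ k; (2) f_{k+l} = v_l·q_k + u_{l−1}·q_{k+1} for 1 ≤ l ≤ s−1; (3) f_{k+s−1+j} = q_{k+1+j} for 0 ≤ j ≤ r−2−k. In particular f_{r+s−4} = q_{r−2} = 1 and f_{r+s−3} = q_{r−1} = 0. -/
theorem eval_Q_add_two (n : ℕ) (t : ℝ) :
    (Q (n + 2)).eval t = t * (Q (n + 1)).eval t - (Q n).eval t := by
  simp [Q]

/-- Two sequences satisfying the same second-order recurrence up to `N`, with equal initial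
values, agree up to `N`. -/
theorem eq_of_continuant_recurrence {R : Type*} [Ring R] {c g h : ℕ → R} {N : ℕ}
    (h0 : g 0 = h 0) (h1 : g 1 = h 1)
    (hg : ∀ j, j + 2 ≤ N → g (j + 2) = c j * g (j + 1) - g j)
    (hh : ∀ j, j + 2 ≤ N → h (j + 2) = c j * h (j + 1) - h j) :
    ∀ j, j ≤ N → g j = h j := by
  intro j
  induction j using Nat.twoStepInduction with
  | zero => exact fun _ => h0
  | one => exact fun _ => h1
  | more j ih0 ih1 =>
    intro hj
    rw [hg j hj, hh j hj, ih0 (by lia), ih1 (by lia)]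

/-- second case of the gluing argument.  Let `r, s ≥ 3` and let `t`
satisfy `Q (r-2) (t) = 1`, `Q (r-1) (t) = 0`; write `q l = Q l (t)`.  Let
`a 1, …, a s` be reals and let `(v j)`, `(u j)` be the diagonals
`v 0 = 1`, `v 1 = a 1`, `v (j+1) = a (j+1) * v j - v (j-1)` and
`u 0 = 1`, `u 1 = a 2`, `u (j+1) = a (j+2) * u j - u (j-1)`, with the frieze boundary
conditions `v (s-2) = 1`, `v (s-1) = 0`, `u (s-2) = 1`, `u (s-1) = 0`.
Fix `k` with `1 ≤ k ≤ r-3` and define `(b j)` by `b j = t` for `1 ≤ j ≤ k`,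
`b (k+1) = a 1 + t`, `b (k+1+l) = a (1+l)` for `1 ≤ l ≤ s-2`, `b (k+s) = a s + t`,
and `b (k+s+l) = t` for `1 ≤ l ≤ r-3-k`.  If `(f j)` is the diagonal built from
`(b j)`, then
(1) `f l = q l` for `0 ≤ l ≤ k`;
(2) `f (k+l) = v l * q k + u (l-1) * q (k+1)` for `1 ≤ l ≤ s-1`;
(3) `f (k+s-1+j) = q (k+1+j)` for `0 ≤ j ≤ r-2-k`.
In particular `f (r+s-4) = q (r-2) = 1` and `f (r+s-3) = q (r-1) = 0`. -/
theorem glued_diagonal_second_case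
    (r s : ℕ) (hr : 3 ≤ r) (hs : 3 ≤ s) (t : ℝ)
    (hq1 : (Q (r - 2)).eval t = 1) (hq2 : (Q (r - 1)).eval t = 0)
    (a v u b f : ℕ → ℝ)
    (hv0 : v 0 = 1) (hv1 : v 1 = a 1)
    (hv : ∀ j, 1 ≤ j → v (j + 1) = a (j + 1) * v j - v (j - 1))
    (hu0 : u 0 = 1) (hu1 : u 1 = a 2)
    (hu : ∀ j, 1 ≤ j → u (j + 1) = a (j + 2) * u j - u (j - 1))
    (hvs2 : v (s - 2) = 1) (hvs1 : v (s - 1) = 0)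
    (hus2 : u (s - 2) = 1) (hus1 : u (s - 1) = 0)
    (k : ℕ) (hk1 : 1 ≤ k) (hk2 : k ≤ r - 3)
    (hb1 : ∀ j, 1 ≤ j → j ≤ k → b j = t)
    (hb2 : b (k + 1) = a 1 + t)
    (hb3 : ∀ l, 1 ≤ l → l ≤ s - 2 → b (k + 1 + l) = a (1 + l))
    (hb4 : b (k + s) = a s + t)
    (hb5 : ∀ l, 1 ≤ l → l ≤ r - 3 - k → b (k + s + l) = t)
    (hf0 : f 0 = 1) (hf1 : f 1 = b 1)
    (hf : ∀ j, 1 ≤ j → f (j + 1) = b (j + 1) * f j - f (j - 1)) :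
    (∀ l, l ≤ k → f l = (Q l).eval t) ∧
    (∀ l, 1 ≤ l → l ≤ s - 1 →
      f (k + l) = v l * (Q k).eval t + u (l - 1) * (Q (k + 1)).eval t) ∧
    (∀ j, j ≤ r - 2 - k → f (k + s - 1 + j) = (Q (k + 1 + j)).eval t) ∧
    f (r + s - 4) = 1 ∧ f (r + s - 3) = 0 := by
  have hf' (j : ℕ) : f (j + 2) = b (j + 2) * f (j + 1) - f j := hf (j + 1) (by lia)
  have hv' (j : ℕ) : v (j + 2) = a (j + 2) * v (j + 1) - v j := hv (j + 1) (by lia)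
  have hu' (j : ℕ) : u (j + 2) = a (j + 3) * u (j + 1) - u j := hu (j + 1) (by lia)
  obtain ⟨n, rfl⟩ : ∃ n, s = n + 3 := ⟨s - 3, by lia⟩
  obtain ⟨m, rfl⟩ : ∃ m, k = m + 1 := ⟨k - 1, by lia⟩
  obtain ⟨p, rfl⟩ : ∃ p, r = m + p + 4 := ⟨r - m - 4, by lia⟩
  simp only [show n + 3 - 2 = n + 1 by lia, show n + 3 - 1 = n + 2 by lia,
    show m + p + 4 - 2 = m + p + 2 by lia, show m + p + 4 - 1 = m + p + 3 by lia,
    show m + p + 4 - 3 - (m + 1) = p by lia] at *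
  have first : ∀ l, l ≤ m + 1 → f l = (Q l).eval t := by
    refine eq_of_continuant_recurrence (c := fun _ => t) (by simp [hf0, Q]) ?_ ?_ ?_
    · simp [hf1, hb1 1 le_rfl hk1, Q]
    · intro j hj
      rw [hf', hb1 (j + 2) (by lia) hj]
    · exact fun j _ => eval_Q_add_two j t
  have f_add_two : f (m + 2) = v 1 * (Q (m + 1)).eval t + u 0 * (Q (m + 2)).eval t := by
    rw [hf', hb2, first m (by lia), first (m + 1) le_rfl, eval_Q_add_two, hv1, hu0]
    ring
  have middle : ∀ l, l ≤ n + 1 → f (m + 2 + l) =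
      v (l + 1) * (Q (m + 1)).eval t + u l * (Q (m + 2)).eval t := by
    have hb (l : ℕ) (hl : l ≤ n) : b (m + 3 + l) = a (l + 2) := by
      have := hb3 (l + 1) (by lia) (by lia)
      rwa [show m + 1 + 1 + (l + 1) = m + 3 + l by lia, show 1 + (l + 1) = l + 2 by lia] at this
    refine eq_of_continuant_recurrence (c := fun j => a (j + 3)) f_add_two ?_ ?_ ?_
    · rw [show m + 2 + 1 = m + 1 + 2 by lia, hf', show m + 1 + 2 = m + 3 + 0 by lia,
        hb 0 (by lia), first (m + 1) le_rfl, f_add_two, hv', hv0, hu0, hu1]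
      ring
    · intro j hj
      rw [← add_assoc, hf', show m + 2 + j + 2 = m + 3 + (j + 1) by lia, hb (j + 1) (by lia)]
      rfl
    · intro j _
      rw [hu', hv' (j + 1)]
      ring
  have last : ∀ j, j ≤ p + 1 → f (m + n + 3 + j) = (Q (m + 2 + j)).eval t := by
    have f_start : f (m + n + 3) = (Q (m + 2)).eval t := by
      have := middle (n + 1) le_rfl
      rw [show m + 2 + (n + 1) = m + n + 3 by lia, hvs1, hus2] at this
      simpa using this
    refine eq_of_continuant_recurrence (c := fun _ => t) f_start ?_ ?_ ?_
    · have hfn := middle n (by lia)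
      have hun : u n = a (n + 3) := by
        have := hu' n
        rw [hus1, hus2] at this
        linarith
      rw [show m + 2 + n = m + n + 2 by lia, hvs2, hun] at hfn
      rw [show m + n + 3 + 1 = m + n + 2 + 2 by lia, hf',
        show m + n + 2 + 2 = m + 1 + (n + 3) by lia, hb4, hfn, f_start,
        show m + 2 + 1 = m + 1 + 2 by lia, eval_Q_add_two (m + 1)]
      ring
    · intro j hj
      rw [← add_assoc, hf',
        show m + n + 3 + j + 2 = m + 1 + (n + 3) + (j + 1) by lia, hb5 (j + 1) (by lia) (by lia)]
      rfl
    · exact fun j _ => eval_Q_add_two (m + 2 + j) t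
  refine ⟨first, ?_, ?_, ?_, ?_⟩
  · intro l hl1 hl
    obtain ⟨l, rfl⟩ : ∃ i, l = i + 1 := ⟨l - 1, by lia⟩
    rw [show m + 1 + (l + 1) = m + 2 + l by lia]
    exact middle l (by lia)
  · intro j hj
    rw [show m + 1 + (n + 3) - 1 + j = m + n + 3 + j by lia]
    exact last j (by lia)
  · rw [show m + p + 4 + (n + 3) - 4 = m + n + 3 + p by lia, last p (by lia),
      show m + 2 + p = m + p + 2 by lia, hq1]
  · rw [show m + p + 4 + (n + 3) - 3 = m + n + 3 + (p + 1) by lia, last (p + 1) le_rfl,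
      show m + 2 + (p + 1) = m + p + 3 by lia, hq2]
end

section
/- Let m ≥ 4 and let σ be a partition of a convex m-gon with vertices v_1, …, v_m (in counterclockwise order) into polygonal parts by pairwise nonintersecting diagonals. Assign to each part that is an n-gon the weight 2cos(π/n), and let w(v_i) be the sum of the weights of the parts adjoining the vertex v_i. Then the m-periodic sequence …, w(v_1), w(v_2), …, w(v_m), … is the first row of a frieze pattern of width m−3; equivalently, for every index j (taken modulo m), the sequence defined by d_0 = 1, d_1 = w(v_j), d_{i+1} = w(v_{j+i})·d_i − d_{i−1} satisfies d_{m−2} = 1 and d_{m−1} = 0. -/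
/-- A dissection (partition by pairwise nonintersecting diagonals) of a convex `m`-gon
whose vertices are labelled by `ZMod m` in counterclockwise order, recorded as the
finite set of its cells, each cell being the set of vertices of the corresponding
polygonal part.  A dissection is either the trivial partition with the single cell
consisting of all vertices, or is obtained from a dissection by cutting one of its
cells `C` along a chord joining two vertices `a ≠ b` of `C`: the two new cells are the
sets of vertices of `C` lying on the two closed arcs from `a` to `b` (here `(c - a).val`
measures the counterclockwise distance from `a` to `c`), and each of them must contain
at least `3` vertices (so the chord is a genuine diagonal and every part is a polygon). -/
inductive IsDissection (m : ℕ) [NeZero m] : Finset (Finset (ZMod m)) → Prop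
  | trivial : IsDissection m {Finset.univ}
  | split (P : Finset (Finset (ZMod m))) (C : Finset (ZMod m)) (a b : ZMod m)
      (hP : IsDissection m P) (hC : C ∈ P) (ha : a ∈ C) (hb : b ∈ C) (hab : a ≠ b)
      (h₁ : 3 ≤ (C.filter fun c => (c - a).val ≤ (b - a).val).card)
      (h₂ : 3 ≤ (C.filter fun c => (c - b).val ≤ (a - b).val).card) :
      IsDissection m (insert (C.filter fun c => (c - a).val ≤ (b - a).val)
        (insert (C.filter fun c => (c - b).val ≤ (a - b).val) (P.erase C)))

/-- The ordered product `N j * N (j + 1) * ⋯ * N (j + k - 1)`. -/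
def arcProd {m : ℕ} {G : Type*} [Monoid G] (N : ZMod m → G) (j : ZMod m) : ℕ → G
  | 0 => 1
  | k + 1 => arcProd N j k * N (j + (k : ZMod m))

section ArcProd

variable {m : ℕ} {G : Type*} [Monoid G]

theorem arcProd_add (N : ZMod m → G) (j : ZMod m) (k l : ℕ) :
    arcProd N j (k + l) = arcProd N j k * arcProd N (j + (k : ZMod m)) l := by
  induction l with
  | zero => simp [arcProd]
  | succ l ih =>
    rw [← add_assoc, arcProd, ih, arcProd, mul_assoc]
    push_cast
    rw [add_assoc]

theorem arcProd_one (N : ZMod m → G) (j : ZMod m) : arcProd N j 1 = N j := by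
  simp [arcProd]

theorem arcProd_congr {N N' : ZMod m → G} {j : ZMod m} {k : ℕ}
    (h : ∀ i < k, N (j + (i : ZMod m)) = N' (j + (i : ZMod m))) :
    arcProd N j k = arcProd N' j k := by
  induction k with
  | zero => rfl
  | succ k ih =>
    rw [arcProd, arcProd, ih fun i hi => h i (by omega), h k (by omega)]

theorem arcProd_eq_one {N : ZMod m → G} {j : ZMod m} {k : ℕ}
    (h : ∀ i < k, N (j + (i : ZMod m)) = 1) : arcProd N j k = 1 := by
  induction k with
  | zero => rfl
  | succ k ih => rw [arcProd, ih fun i hi => h i (by omega), h k (by omega), one_mul]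

/-- A full turn starting at `a` factors through the vertex `a + k`. -/
theorem arcProd_full_turn (N : ZMod m → G) (a : ZMod m) {k : ℕ} (hk : 0 < k) (hkm : k < m) :
    arcProd N a m = N a * arcProd N (a + 1) (k - 1) * N (a + (k : ZMod m)) *
      arcProd N (a + (k : ZMod m) + 1) (m - 1 - k) := by
  obtain ⟨k, rfl⟩ : ∃ t, k = t + 1 := ⟨k - 1, by omega⟩
  have hm : arcProd N a m = arcProd N a (1 + k + 1 + (m - 1 - (k + 1))) :=
    congrArg _ (by omega)
  rw [hm, arcProd_add, arcProd_add, arcProd_add, arcProd_one, arcProd_one, Nat.add_sub_cancel]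
  push_cast
  simp only [add_comm, add_left_comm]

theorem arcProd_ite_eq_pow (C : Finset (ZMod m)) (A : G) (j : ZMod m) (k : ℕ) :
    arcProd (fun v => if v ∈ C then A else 1) j k =
      A ^ ((Finset.range k).filter fun i => j + ((i : ℕ) : ZMod m) ∈ C).card := by
  induction k with
  | zero => simp [arcProd]
  | succ k ih =>
    rw [arcProd, ih, Finset.range_add_one, Finset.filter_insert]
    split_ifs with h
    · rw [Finset.card_insert_of_notMem (by simp), pow_succ]
    · rw [mul_one]

end ArcProd

theorem card_filter_range_add_mem {m : ℕ} [NeZero m] (C : Finset (ZMod m)) (j : ZMod m) :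
    ((Finset.range m).filter fun i => j + ((i : ℕ) : ZMod m) ∈ C).card = C.card := by
  refine Finset.card_bij (fun i _ => j + (i : ZMod m)) (fun i hi => (Finset.mem_filter.1 hi).2)
    ?_ ?_
  · intro i hi i' hi' h
    simp only [Finset.mem_filter, Finset.mem_range] at hi hi'
    have := congrArg ZMod.val (add_left_cancel h)
    rwa [ZMod.val_natCast_of_lt hi.1, ZMod.val_natCast_of_lt hi'.1] at this
  · intro c hc
    have : j + (((c - j).val : ℕ) : ZMod m) = c := by simp
    refine ⟨(c - j).val, ?_, this⟩
    rw [Finset.mem_filter, this]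
    exact ⟨Finset.mem_range.2 (ZMod.val_lt _), hc⟩

/-- The matrix whose products generate the diagonals of a frieze. -/
def friezeMat (x : ℝ) : Matrix (Fin 2) (Fin 2) ℝ := !![x, -1; 1, 0]

theorem sin_smul_friezeMat_pow (θ : ℝ) (n : ℕ) :
    Real.sin θ • friezeMat (2 * Real.cos θ) ^ n =
      !![Real.sin ((n + 1) * θ), -Real.sin (n * θ); Real.sin (n * θ), -Real.sin ((n - 1) * θ)] := by
  induction n with
  | zero => ext i j; fin_cases i <;> fin_cases j <;> simp
  | succ n ih =>
    have h (t : ℝ) : Real.sin ((t + 1) * θ) =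
        2 * Real.cos θ * Real.sin (t * θ) - Real.sin ((t - 1) * θ) := by
      rw [add_mul, sub_mul, one_mul, Real.sin_add, Real.sin_sub]
      ring
    rw [pow_succ, ← smul_mul_assoc, ih, friezeMat]
    push_cast
    have h₁ := h (n + 1)
    have h₂ := h n
    simp only [add_sub_cancel_right] at h₁ ⊢
    ext i j
    fin_cases i <;> fin_cases j <;> simp [Matrix.mul_apply, Fin.sum_univ_two] <;> linarith

theorem friezeMat_pow_eq_neg_one {n : ℕ} (hn : 2 ≤ n) :
    friezeMat (2 * Real.cos (Real.pi / n)) ^ n = -1 := by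
  have hn' : (2 : ℝ) ≤ n := by exact_mod_cast hn
  have hsin : Real.sin (Real.pi / n) ≠ 0 := by
    refine (Real.sin_pos_of_pos_of_lt_pi (by positivity) ?_).ne'
    exact div_lt_self Real.pi_pos (by linarith)
  have h := sin_smul_friezeMat_pow (Real.pi / n) n
  have e : (n : ℝ) * (Real.pi / n) = Real.pi := by field_simp
  rw [add_mul, sub_mul, one_mul, e, add_comm, Real.sin_add_pi, Real.sin_pi, Real.sin_pi_sub] at h
  refine smul_right_injective _ hsin (h.trans ?_)
  ext i j
  fin_cases i <;> fin_cases j <;> simp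

theorem friezeMat_glue {x x' y y' : ℝ} {X Y : Matrix (Fin 2) (Fin 2) ℝ}
    (h₁ : friezeMat x * X * friezeMat y = -1) (h₂ : friezeMat x' * friezeMat y' * Y = -1) :
    friezeMat (x + x') * X * friezeMat (y + y') * Y = -1 := by
  have hZ : friezeMat y' * Y = !![0, -1; 1, -x'] := by
    have hinv : !![0, 1; -1, x'] * friezeMat x' = 1 := by
      ext i j
      fin_cases i <;> fin_cases j <;> simp [friezeMat, Matrix.mul_apply, Fin.sum_univ_two]
    calc friezeMat y' * Y = !![0, 1; -1, x'] * (friezeMat x' * friezeMat y' * Y) := by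
          rw [mul_assoc, ← mul_assoc _ (friezeMat x'), hinv, one_mul]
      _ = _ := by
          rw [h₂]
          ext i j
          fin_cases i <;> fin_cases j <;> simp
  have hx : friezeMat (x + x') = !![1, x'; 0, 1] * friezeMat x := by
    ext i j
    fin_cases i <;> fin_cases j <;> simp [friezeMat, Matrix.mul_apply, Fin.sum_univ_two]
  have hy : friezeMat (y + y') = friezeMat y * !![0, 1; -1, 0] * friezeMat y' := by
    ext i j
    fin_cases i <;> fin_cases j <;>
      simp [friezeMat, Matrix.mul_apply, Fin.sum_univ_two, add_comm]
  calc friezeMat (x + x') * X * friezeMat (y + y') * Y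
      = !![1, x'; 0, 1] * (friezeMat x * X * friezeMat y) * !![0, 1; -1, 0] *
          (friezeMat y' * Y) := by
        rw [hx, hy]
        simp only [mul_assoc]
    _ = -1 := by
        rw [h₁, hZ]
        ext i j
        fin_cases i <;> fin_cases j <;> simp [Matrix.mul_apply, Fin.sum_univ_two]

/-- The frieze matrix of `q` at the vertices of `C`, and the identity elsewhere. -/
noncomputable def cellMat {m : ℕ} (C : Finset (ZMod m)) (q : ZMod m → ℝ) (v : ZMod m) :
    Matrix (Fin 2) (Fin 2) ℝ :=
  if v ∈ C then friezeMat (q v) else 1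

/-- `q` restricted to `C` is the first row of a frieze pattern on the polygon `C`. -/
def IsQuiddity {m : ℕ} (C : Finset (ZMod m)) (q : ZMod m → ℝ) : Prop :=
  ∀ j, arcProd (cellMat C q) j m = -1

theorem add_natCast_sub_val_le_iff {m : ℕ} (a : ZMod m) {i k : ℕ} (hi : i < m) (hk : k < m) :
    (a + i - a).val ≤ (a + k - a).val ↔ i ≤ k := by
  rw [add_sub_cancel_left, add_sub_cancel_left, ZMod.val_natCast_of_lt hi,
    ZMod.val_natCast_of_lt hk]

theorem natCast_sub_natCast_val {m i k : ℕ} (hi : i < m) (hk : k < m) :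
    ((i : ZMod m) - k).val = if k ≤ i then i - k else i + m - k := by
  split_ifs with h
  · rw [← Nat.cast_sub h, ZMod.val_natCast_of_lt (by omega)]
  · have : ((i : ZMod m) - k) = ((i + m - k : ℕ) : ZMod m) := by
      rw [Nat.cast_sub (by omega)]
      simp
    rw [this, ZMod.val_natCast_of_lt (by omega)]

theorem add_natCast_sub_val_le_iff' {m : ℕ} (a : ZMod m) {i k : ℕ} (hi : i < m) (hk : k < m)
    (hk0 : 0 < k) :
    (a + i - (a + k)).val ≤ (a - (a + k)).val ↔ k ≤ i ∨ i = 0 := by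
  have h : a - (a + k) = ((0 : ℕ) : ZMod m) - k := by push_cast; ring
  rw [h, add_sub_add_left_eq_sub, natCast_sub_natCast_val hi hk,
    natCast_sub_natCast_val (by omega) hk]
  split_ifs <;> omega

section Quiddity

variable {m : ℕ} [NeZero m]

theorem isQuiddity_of_arcProd {C : Finset (ZMod m)} {q : ZMod m → ℝ} {j : ZMod m}
    (h : arcProd (cellMat C q) j m = -1) : IsQuiddity C q := by
  have key (i : ℕ) : arcProd (cellMat C q) (j + (i : ZMod m)) m = -1 := by
    induction i with
    | zero => simpa using h
    | succ i ih =>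
      obtain ⟨n, hn⟩ : ∃ n, m = n + 1 := ⟨m - 1, by have := NeZero.pos m; omega⟩
      have h₁ : arcProd (cellMat C q) (j + (i : ZMod m)) m = cellMat C q (j + i) *
          arcProd (cellMat C q) (j + ((i + 1 : ℕ) : ZMod m)) n := by
        rw [congrArg (arcProd _ _) (hn.trans (add_comm n 1)), arcProd_add, arcProd_one]
        push_cast
        rw [add_assoc]
      have h₂ : arcProd (cellMat C q) (j + ((i + 1 : ℕ) : ZMod m)) m =
          arcProd (cellMat C q) (j + ((i + 1 : ℕ) : ZMod m)) n * cellMat C q (j + i) := by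
        rw [congrArg (arcProd _ _) hn, arcProd]
        congr 2
        have : ((n : ZMod m) + 1) = 0 := by
          have := (congrArg (Nat.cast : ℕ → ZMod m) hn).symm.trans (ZMod.natCast_self m)
          exact_mod_cast this
        push_cast
        linear_combination this
      rw [h₁, ← neg_eq_iff_eq_neg, ← mul_neg, mul_eq_one_comm, neg_mul, neg_eq_iff_eq_neg] at ih
      rw [h₂, ih]
  intro j'
  have := key (j' - j).val
  simpa using this

theorem isQuiddity_const {C : Finset (ZMod m)} (hC : 2 ≤ C.card) :
    IsQuiddity C fun _ => 2 * Real.cos (Real.pi / C.card) := by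
  intro j
  have h := arcProd_ite_eq_pow C (friezeMat (2 * Real.cos (Real.pi / C.card))) j m
  rw [card_filter_range_add_mem, friezeMat_pow_eq_neg_one hC] at h
  exact h

/-- Quiddities of the two pieces of a cell cut along a chord add up to one of the cell. -/
theorem IsQuiddity.glue {C : Finset (ZMod m)} {a b : ZMod m} (ha : a ∈ C) (hb : b ∈ C)
    (hab : a ≠ b) {q₁ q₂ : ZMod m → ℝ}
    (h₁ : IsQuiddity (C.filter fun c => (c - a).val ≤ (b - a).val) q₁)
    (h₂ : IsQuiddity (C.filter fun c => (c - b).val ≤ (a - b).val) q₂) :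
    IsQuiddity C fun v =>
      (if v ∈ C.filter fun c => (c - a).val ≤ (b - a).val then q₁ v else 0) +
        (if v ∈ C.filter fun c => (c - b).val ≤ (a - b).val then q₂ v else 0) := by
  obtain ⟨k, hkm, hk0, rfl⟩ : ∃ k < m, 0 < k ∧ b = a + (k : ZMod m) := by
    refine ⟨(b - a).val, ZMod.val_lt _, ?_, by simp⟩
    rw [ZMod.val_pos]
    exact sub_ne_zero.2 hab.symm
  set C₁ := C.filter fun c => (c - a).val ≤ (a + (k : ZMod m) - a).val with hC₁
  set C₂ := C.filter fun c => (c - (a + (k : ZMod m))).val ≤ (a - (a + (k : ZMod m))).val with hC₂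
  have mem₁ {i : ℕ} (hi : i < m) :
      a + (i : ZMod m) ∈ C₁ ↔ a + (i : ZMod m) ∈ C ∧ i ≤ k := by
    rw [hC₁, Finset.mem_filter, add_natCast_sub_val_le_iff a hi hkm]
  have mem₂ {i : ℕ} (hi : i < m) :
      a + (i : ZMod m) ∈ C₂ ↔ a + (i : ZMod m) ∈ C ∧ (k ≤ i ∨ i = 0) := by
    rw [hC₂, Finset.mem_filter, add_natCast_sub_val_le_iff' a hi hkm hk0]
  have a₁ : a ∈ C₁ := by simpa [ha] using mem₁ (i := 0) (by omega)
  have a₂ : a ∈ C₂ := by simpa [ha] using mem₂ (i := 0) (by omega)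
  have b₁ : a + (k : ZMod m) ∈ C₁ := by simp [mem₁ hkm, hb]
  have b₂ : a + (k : ZMod m) ∈ C₂ := by simp [mem₂ hkm, hb]
  have e₁ (i : ℕ) : a + 1 + (i : ZMod m) = a + ((i + 1 : ℕ) : ZMod m) := by push_cast; ring
  have e₂ (i : ℕ) : a + (k : ZMod m) + 1 + (i : ZMod m) = a + ((k + 1 + i : ℕ) : ZMod m) := by
    push_cast; ring
  have h₁a := h₁ a
  have h₂a := h₂ a
  rw [arcProd_full_turn _ a hk0 hkm] at h₁a h₂a
  refine isQuiddity_of_arcProd (j := a) ?_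
  rw [arcProd_full_turn _ a hk0 hkm]
  have t₁ : arcProd (cellMat C₁ q₁) (a + (k : ZMod m) + 1) (m - 1 - k) = 1 :=
    arcProd_eq_one fun i hi => by
      rw [e₂, cellMat, if_neg]
      rw [mem₁ (by omega)]
      omega
  have t₂ : arcProd (cellMat C₂ q₂) (a + 1) (k - 1) = 1 :=
    arcProd_eq_one fun i hi => by
      rw [e₁, cellMat, if_neg]
      rw [mem₂ (by omega)]
      omega
  rw [t₁, mul_one] at h₁a
  rw [t₂, mul_one] at h₂a
  simp only [cellMat, if_pos a₁, if_pos b₁] at h₁a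
  simp only [cellMat, if_pos a₂, if_pos b₂] at h₂a
  have h := friezeMat_glue h₁a h₂a
  simp only [cellMat, if_pos ha, if_pos hb, if_pos a₁, if_pos b₁, if_pos a₂, if_pos b₂]
  rw [← h]
  congr 1
  · congr 2
    refine arcProd_congr fun i hi => ?_
    have hm₁ := mem₁ (i := i + 1) (by omega)
    have hm₂ := mem₂ (i := i + 1) (by omega)
    rw [← e₁] at hm₁ hm₂
    have n₂ : a + 1 + (i : ZMod m) ∉ C₂ := by rw [hm₂]; omega
    have i₁ : a + 1 + (i : ZMod m) ∈ C₁ ↔ a + 1 + (i : ZMod m) ∈ C := by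
      rw [hm₁, and_iff_left (by omega)]
    by_cases hc : a + 1 + (i : ZMod m) ∈ C <;> simp [cellMat, i₁, n₂, hc]
  · refine arcProd_congr fun i hi => ?_
    have hm₁ := mem₁ (i := k + 1 + i) (by omega)
    have hm₂ := mem₂ (i := k + 1 + i) (by omega)
    rw [← e₂] at hm₁ hm₂
    have n₁ : a + (k : ZMod m) + 1 + (i : ZMod m) ∉ C₁ := by rw [hm₁]; omega
    have i₂ : a + (k : ZMod m) + 1 + (i : ZMod m) ∈ C₂ ↔
        a + (k : ZMod m) + 1 + (i : ZMod m) ∈ C := by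
      rw [hm₂, and_iff_left (by omega)]
    by_cases hc : a + (k : ZMod m) + 1 + (i : ZMod m) ∈ C <;> simp [cellMat, i₂, n₁, hc]

theorem card_inter_arcs_le_two (C : Finset (ZMod m)) {a b : ZMod m} (hab : a ≠ b) :
    ((C.filter fun c => (c - a).val ≤ (b - a).val) ∩
      (C.filter fun c => (c - b).val ≤ (a - b).val)).card ≤ 2 := by
  refine (Finset.card_le_card (t := {a, b}) fun c hc => ?_).trans Finset.card_le_two
  obtain ⟨k, hkm, hk0, rfl⟩ : ∃ k < m, 0 < k ∧ b = a + (k : ZMod m) := by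
    refine ⟨(b - a).val, ZMod.val_lt _, ?_, by simp⟩
    rw [ZMod.val_pos]
    exact sub_ne_zero.2 hab.symm
  obtain ⟨i, hi, rfl⟩ : ∃ i < m, c = a + (i : ZMod m) :=
    ⟨(c - a).val, ZMod.val_lt _, by simp⟩
  rw [Finset.mem_inter, Finset.mem_filter, Finset.mem_filter, add_natCast_sub_val_le_iff a hi hkm,
    add_natCast_sub_val_le_iff' a hi hkm hk0] at hc
  obtain rfl | rfl : i = k ∨ i = 0 := by omega
  · simp
  · simp

theorem IsDissection.three_le_card (hm : 3 ≤ m) {P : Finset (Finset (ZMod m))}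
    (hP : IsDissection m P) : ∀ C ∈ P, 3 ≤ C.card := by
  induction hP with
  | trivial => simpa [ZMod.card] using hm
  | split P C a b hP hC ha hb hab h₁ h₂ ih =>
    intro D hD
    simp only [Finset.mem_insert, Finset.mem_erase] at hD
    rcases hD with rfl | rfl | ⟨-, hD⟩
    exacts [h₁, h₂, ih D hD]

theorem IsDissection.card_inter_le_two {P : Finset (Finset (ZMod m))}
    (hP : IsDissection m P) : ∀ C ∈ P, ∀ D ∈ P, C ≠ D → (C ∩ D).card ≤ 2 := by
  induction hP with
  | trivial =>
    intro C hC D hD h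
    simp only [Finset.mem_singleton] at hC hD
    exact absurd (hC.trans hD.symm) h
  | split P C a b hP hC ha hb hab h₁ h₂ ih =>
    have hsub {p : ZMod m → Prop} [DecidablePred p] {D : Finset (ZMod m)} (hD : D ≠ C ∧ D ∈ P) :
        (C.filter p ∩ D).card ≤ 2 :=
      (Finset.card_le_card (Finset.inter_subset_inter_right (Finset.filter_subset _ _))).trans
        (ih C hC D hD.2 hD.1.symm)
    intro D hD E hE h
    simp only [Finset.mem_insert, Finset.mem_erase] at hD hE
    rcases hD with rfl | rfl | hD <;> rcases hE with rfl | rfl | hE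
    · exact absurd rfl h
    · exact card_inter_arcs_le_two C hab
    · exact hsub hE
    · exact card_inter_arcs_le_two C hab.symm
    · exact absurd rfl h
    · exact hsub hE
    · rw [Finset.inter_comm]; exact hsub hD
    · rw [Finset.inter_comm]; exact hsub hD
    · exact ih D hD.2 E hE.2 h

/-- Quiddities of the cells of a dissection add up to a quiddity of the whole polygon. -/
theorem IsDissection.isQuiddity_sum {P : Finset (Finset (ZMod m))} (hP : IsDissection m P)
    (q : Finset (ZMod m) → ZMod m → ℝ) (hq : ∀ C ∈ P, IsQuiddity C (q C)) :
    IsQuiddity Finset.univ fun v => ∑ C ∈ P, if v ∈ C then q C v else 0 := by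
  induction hP generalizing q with
  | trivial => simpa using hq
  | split P C a b hP hC ha hb hab h₁ h₂ ih =>
    set C₁ := C.filter fun c => (c - a).val ≤ (b - a).val with hC₁
    set C₂ := C.filter fun c => (c - b).val ≤ (a - b).val with hC₂
    have hnot {D : Finset (ZMod m)} (hDC : D ⊆ C) (hD : 3 ≤ D.card) : D ∉ P.erase C := by
      intro hDP
      rw [Finset.mem_erase] at hDP
      have := hP.card_inter_le_two D hDP.2 C hC hDP.1
      rw [Finset.inter_eq_left.2 hDC] at this
      omega
    have sub₁ : C₁ ⊆ C := Finset.filter_subset _ _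
    have sub₂ : C₂ ⊆ C := Finset.filter_subset _ _
    have hne : C₁ ≠ C₂ := by
      intro h
      have := card_inter_arcs_le_two C hab
      rw [← hC₁, ← hC₂, ← h, Finset.inter_self] at this
      omega
    have hglue := IsQuiddity.glue ha hb hab (hq C₁ (by simp)) (hq C₂ (by simp))
    rw [← hC₁, ← hC₂] at hglue
    have := ih (Function.update q C fun v =>
      (if v ∈ C₁ then q C₁ v else 0) + (if v ∈ C₂ then q C₂ v else 0)) fun D hD => by
        by_cases h : D = C
        · subst h
          simpa using hglue
        · rw [Function.update_of_ne h]
          exact hq D (by simp [h, hD])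
    convert this using 2 with v
    rw [Finset.sum_insert (by simpa [hne] using hnot sub₁ h₁), Finset.sum_insert (hnot sub₂ h₂),
      ← Finset.add_sum_erase P _ hC, ← add_assoc, Function.update_self]
    congr 1
    · by_cases hv : v ∈ C
      · rw [if_pos hv]
      · rw [if_neg hv, if_neg fun h => hv (sub₁ h), if_neg fun h => hv (sub₂ h), add_zero]
    · refine Finset.sum_congr rfl fun D hD => ?_
      rw [Function.update_of_ne (Finset.ne_of_mem_erase hD)]

end Quiddity

/-- The first row of a product of frieze matrices holds consecutive diagonal entries. -/
theorem arcProd_friezeMat_row {m : ℕ} {w : ZMod m → ℝ} {j : ZMod m} {d : ℕ → ℝ}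
    (hd0 : d 0 = 1) (hd1 : d 1 = w j)
    (hd : ∀ i, 1 ≤ i → d (i + 1) = w (j + (i : ZMod m)) * d i - d (i - 1)) (i : ℕ) :
    arcProd (fun v => friezeMat (w v)) j (i + 1) 0 0 = d (i + 1) ∧
      arcProd (fun v => friezeMat (w v)) j (i + 1) 0 1 = -d i := by
  induction i with
  | zero => simp [arcProd, friezeMat, hd0, hd1]
  | succ i ih =>
    rw [arcProd, Matrix.mul_apply, Matrix.mul_apply, Fin.sum_univ_two, Fin.sum_univ_two, ih.1, ih.2,
      hd (i + 1) (by omega)]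
    simp [friezeMat]
    ring

/-- Let `m ≥ 4` and let `P` be a partition of a convex `m`-gon with
vertices `v_1, …, v_m` (in counterclockwise order, labelled here by `ZMod m`) into
polygonal parts by pairwise nonintersecting diagonals.  Give each part that is an
`n`-gon the weight `2 cos (π / n)` and let `w v` be the sum of the weights of the parts
adjoining the vertex `v`.  Then the `m`-periodic sequence `…, w v_1, …, w v_m, …` is the
first row of a frieze pattern of width `m - 3`: for every starting index `j` (taken
modulo `m`), the diagonal sequence `d 0 = 1`, `d 1 = w j`,
`d (i+1) = w (j + i) * d i - d (i-1)` satisfies `d (m-2) = 1` and `d (m-1) = 0`. -/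
theorem dissection_gives_frieze (m : ℕ) [NeZero m] (hm : 4 ≤ m)
    (P : Finset (Finset (ZMod m))) (hP : IsDissection m P)
    (w : ZMod m → ℝ)
    (hw : ∀ v : ZMod m,
      w v = ∑ C ∈ P.filter (fun C => v ∈ C), 2 * Real.cos (Real.pi / (C.card : ℝ)))
    (j : ZMod m) (d : ℕ → ℝ)
    (hd0 : d 0 = 1) (hd1 : d 1 = w j)
    (hd : ∀ i, 1 ≤ i → d (i + 1) = w (j + (i : ZMod m)) * d i - d (i - 1)) :
    d (m - 2) = 1 ∧ d (m - 1) = 0 := by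
  have hq : IsQuiddity Finset.univ w := by
    have h := hP.isQuiddity_sum (fun C _ => 2 * Real.cos (Real.pi / C.card)) fun C hC =>
      isQuiddity_const (by have := hP.three_le_card (by omega) C hC; omega)
    convert h using 2 with v
    rw [hw, Finset.sum_filter]
  have hcyc : arcProd (fun v => friezeMat (w v)) j m = -1 := by
    rw [← hq j]
    exact arcProd_congr fun i _ => by simp [cellMat]
  have hrow := arcProd_friezeMat_row hd0 hd1 hd (m - 1)
  have hlast := hd (m - 1) (by omega)
  rw [show m - 1 + 1 = m by omega] at hrow hlast
  rw [hcyc] at hrow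
  obtain ⟨h₁, h₂⟩ := hrow
  simp only [Matrix.neg_apply, Matrix.one_apply_eq, Matrix.one_apply_ne zero_ne_one,
    neg_inj] at h₁ h₂
  rw [← h₁, ← h₂, mul_zero, zero_sub, neg_inj, Nat.sub_sub] at hlast
  exact ⟨hlast.symm, h₂.symm⟩
end
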